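/- arXiv:1412.1160 — 6 statements merged into one kernel-verified Lean document; each statement's English description precedes it below -/
import Mathlib

section
/- Let p ≥ 2 be a real number, α₁ > 0, let ψ₁ : ℝ^N → [0, ∞) be a function, and let f : ℝ^N × ℝ → ℝ satisfy the dissipativity condition f(x,s)·s ≤ −α₁|s|^p + ψ₁(x) for all x ∈ ℝ^N and s ∈ ℝ. Then for every x ∈ ℝ^N, every ρ > 0, and all real numbers u, M with 0 < M < u, one has ρ · f(x, u/ρ) ≤ −(α₁/2) ρ^{2−p} M^{p−2} (u − M) − (α₁/2) ρ^{2−p} (u − M)^{p−1} + ρ² ψ₁(x) / (u − M). -/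
open Real

/-- pointwise dissipative estimate for the rescaled nonlinearity
(key step of Lemma 4.4). -/
theorem rescaled_nonlinearity_estimate (N : ℕ) (p α₁ : ℝ) (hp : 2 ≤ p) (hα : 0 < α₁)
    (ψ₁ : (Fin N → ℝ) → ℝ) (hψ : ∀ x, 0 ≤ ψ₁ x)
    (f : (Fin N → ℝ) → ℝ → ℝ)
    (hf : ∀ x s, f x s * s ≤ -α₁ * |s| ^ p + ψ₁ x) :
    ∀ x : Fin N → ℝ, ∀ ρ > (0 : ℝ), ∀ u M : ℝ, 0 < M → M < u →
      ρ * f x (u / ρ) ≤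
        -(α₁ / 2) * ρ ^ (2 - p) * M ^ (p - 2) * (u - M)
          - (α₁ / 2) * ρ ^ (2 - p) * (u - M) ^ (p - 1)
          + ρ ^ (2 : ℕ) * ψ₁ x / (u - M) := by
  intro x ρ hρ u M hM hMu
  have hu : 0 < u := hM.trans hMu
  have hd : 0 < u - M := sub_pos.mpr hMu
  have h := hf x (u / ρ)
  rw [abs_of_pos (div_pos hu hρ), Real.div_rpow hu.le hρ.le] at h
  have e1 : u ^ p = u ^ (p - 1) * u := by
    rw [← Real.rpow_add_one hu.ne']; congr 1; ring
  have e2 : u ^ (p - 1) = u ^ (p - 2) * u := by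
    rw [← Real.rpow_add_one hu.ne']; congr 1; ring
  have e3 : ρ ^ (2 - p) = ρ ^ 2 / ρ ^ p := by
    rw [Real.rpow_sub hρ]; norm_num
  have hP : 0 < ρ ^ p := Real.rpow_pos_of_pos hρ p
  have k1 : ρ * f x (u / ρ) ≤ -α₁ * ρ ^ (2 - p) * u ^ (p - 1) + ρ ^ 2 * ψ₁ x / u := by
    have h2 := mul_le_mul_of_nonneg_left h (by positivity : 0 ≤ ρ ^ 2 / u)
    have l : ρ ^ 2 / u * (f x (u / ρ) * (u / ρ)) = ρ * f x (u / ρ) := by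
      generalize f x (u / ρ) = F
      field_simp
    have r : ρ ^ 2 / u * (-α₁ * (u ^ p / ρ ^ p) + ψ₁ x)
        = -α₁ * ρ ^ (2 - p) * u ^ (p - 1) + ρ ^ 2 * ψ₁ x / u := by
      rw [e3, e1]
      generalize u ^ (p - 1) = A
      generalize ρ ^ p = P at *
      field_simp
    rwa [l, r] at h2
  have k2 : ρ ^ 2 * ψ₁ x / u ≤ ρ ^ 2 * ψ₁ x / (u - M) :=
    div_le_div_of_nonneg_left (mul_nonneg (by positivity) (hψ x)) hd (by linarith)
  have k3 : M ^ (p - 2) * (u - M) ≤ u ^ (p - 1) := by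
    rw [e2]
    exact mul_le_mul (Real.rpow_le_rpow hM.le hMu.le (by linarith)) (by linarith) hd.le
      (Real.rpow_nonneg hu.le _)
  have k4 : (u - M) ^ (p - 1) ≤ u ^ (p - 1) :=
    Real.rpow_le_rpow hd.le (by linarith) (by linarith)
  have hc : 0 ≤ α₁ / 2 * ρ ^ (2 - p) := by positivity
  have k5 := mul_le_mul_of_nonneg_left (add_le_add k3 k4) hc
  linarith
end

section
/- Let k > 0 and τ ∈ ℝ. Let y : [τ−1, τ] → [0, ∞) be differentiable and G : [τ−1, τ] → [0, ∞) be continuous, and suppose y′(s) + k y(s) ≤ G(s) for all s ∈ [τ−1, τ]. Then y(τ) ≤ ∫_{τ−1}^{τ} e^{k(s−τ)} y(s) ds + ∫_{τ−1}^{τ} e^{k(s−τ)} G(s) ds. -/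
open MeasureTheory Real Filter intervalIntegral

/-- Gronwall-type averaging lemma behind estimate (4.36) in Lemma 4.4. -/
theorem gronwall_average (k τ : ℝ) (hk : 0 < k) (y y' G : ℝ → ℝ)
    (hy : ∀ s ∈ Set.Icc (τ - 1) τ, HasDerivWithinAt y (y' s) (Set.Icc (τ - 1) τ) s)
    (hy0 : ∀ s ∈ Set.Icc (τ - 1) τ, 0 ≤ y s)
    (hG : ContinuousOn G (Set.Icc (τ - 1) τ))
    (hG0 : ∀ s ∈ Set.Icc (τ - 1) τ, 0 ≤ G s)
    (hineq : ∀ s ∈ Set.Icc (τ - 1) τ, y' s + k * y s ≤ G s) :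
    y τ ≤ (∫ s in (τ - 1)..τ, Real.exp (k * (s - τ)) * y s)
      + ∫ s in (τ - 1)..τ, Real.exp (k * (s - τ)) * G s := by
  have hyc : ContinuousOn y (Set.Icc (τ - 1) τ) := fun s hs => (hy s hs).continuousWithinAt
  have hle : τ - 1 ≤ τ := by linarith
  have hc1 : ContinuousOn (fun s => Real.exp (k * (s - τ)) * y s) (Set.Icc (τ - 1) τ) :=
    ContinuousOn.mul (by fun_prop) hyc
  have hc2 : ContinuousOn (fun s => Real.exp (k * (s - τ)) * G s) (Set.Icc (τ - 1) τ) :=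
    ContinuousOn.mul (by fun_prop) hG
  rw [← intervalIntegral.integral_add (hc1.intervalIntegrable_of_Icc hle)
    (hc2.intervalIntegrable_of_Icc hle)]
  have key := intervalIntegral.sub_le_integral_of_hasDeriv_right_of_le
    (g := fun s => (s - τ + 1) * (Real.exp (k * (s - τ)) * y s))
    (g' := fun s => 1 * (Real.exp (k * (s - τ)) * y s) +
      (s - τ + 1) * (Real.exp (k * (s - τ)) * (k * 1) * y s + Real.exp (k * (s - τ)) * y' s))
    (φ := fun s => Real.exp (k * (s - τ)) * y s + Real.exp (k * (s - τ)) * G s)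
    hle (ContinuousOn.mul (by fun_prop) hc1) ?_ (hc1.add hc2).integrableOn_Icc ?_
  · simpa using key
  · intro x hx
    have h1 : HasDerivAt y (y' x) x :=
      (hy x (Set.Ioo_subset_Icc_self hx)).hasDerivAt (Icc_mem_nhds hx.1 hx.2)
    have h2 : HasDerivAt (fun s : ℝ => Real.exp (k * (s - τ)))
        (Real.exp (k * (x - τ)) * (k * 1)) x :=
      (((hasDerivAt_id x).sub_const τ).const_mul k).exp
    have h3 : HasDerivAt (fun s : ℝ => s - τ + 1) 1 x :=
      ((hasDerivAt_id x).sub_const τ).add_const 1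
    exact (h3.mul (h2.mul h1)).hasDerivWithinAt
  · intro x hx
    have hx' := Set.Ioo_subset_Icc_self hx
    have hE := Real.exp_pos (k * (x - τ))
    have a1 := hineq x hx'
    have a2 := hG0 x hx'
    have b1 : 0 ≤ x - τ + 1 := by linarith [hx.1]
    have b2 : x - τ + 1 ≤ 1 := by linarith [hx.2]
    have c : (x - τ + 1) * (y' x + k * y x) ≤ G x :=
      (mul_le_mul_of_nonneg_left a1 b1).trans (mul_le_of_le_one_left a2 b2)
    have d := mul_le_mul_of_nonneg_left c hE.le
    linarith
end

section
/- Let ω : ℝ → ℝ be continuous, let 0 < δ₀ < δ₀₁, ε > 0, and let H : ℝ → [0, ∞) be measurable. Suppose a := sup_{s ≤ 0} e^{(δ₀₁ − δ₀) s + 2ε|ω(s)|} < ∞. Then for every τ ∈ ℝ and every t ≥ 0: ∫_{−∞}^{0} e^{δ₀₁ s + 2ε|ω(s−t) − ω(−t)|} H(s + τ − t) ds ≤ a · e^{δ₀₁ t + 2ε|ω(−t)|} ∫_{−∞}^{−t} e^{δ₀ s} H(s + τ) ds. -/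
open MeasureTheory Real Filter

/-- the change-of-variables estimate (4.9)–(4.11) in the proof of
Lemma 4.1, bounding L_ε(τ − t, θ_{−t}ω). -/
theorem shifted_radius_estimate (ω : ℝ → ℝ) (hω : Continuous ω) (δ₀ δ₀₁ ε : ℝ)
    (h0 : 0 < δ₀) (h01 : δ₀ < δ₀₁) (hε : 0 < ε)
    (H : ℝ → ℝ) (hHm : Measurable H) (hH0 : ∀ s, 0 ≤ H s)
    (a : ℝ) (ha : ∀ s ≤ (0 : ℝ), Real.exp ((δ₀₁ - δ₀) * s + 2 * ε * |ω s|) ≤ a) :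
    ∀ τ : ℝ, ∀ t ≥ (0 : ℝ),
      (∫⁻ s in Set.Iic (0 : ℝ),
          ENNReal.ofReal (Real.exp (δ₀₁ * s + 2 * ε * |ω (s - t) - ω (-t)|) * H (s + τ - t))) ≤
        ENNReal.ofReal (a * Real.exp (δ₀₁ * t + 2 * ε * |ω (-t)|)) *
          ∫⁻ s in Set.Iic (-t), ENNReal.ofReal (Real.exp (δ₀ * s) * H (s + τ)) := by
  intro τ t ht
  rw [← lintegral_const_mul' _ _ ENNReal.ofReal_ne_top, ← lintegral_indicator measurableSet_Iic,
    ← lintegral_indicator measurableSet_Iic,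
    ← lintegral_sub_right_eq_self (μ := volume) (Set.indicator (Set.Iic (-t)) _) t]
  refine lintegral_mono fun s => ?_
  by_cases hs : s ≤ 0
  · have h1 : s ∈ Set.Iic (0 : ℝ) := hs
    have h2 : s - t ∈ Set.Iic (-t) := by
      simp only [Set.mem_Iic]
      linarith
    have h3 : s - t ≤ 0 := by linarith
    have ha' := ha _ h3
    have ha0 : 0 ≤ a := (Real.exp_pos _).le.trans ha'
    simp only [Set.indicator_of_mem h1, Set.indicator_of_mem h2]
    rw [← ENNReal.ofReal_mul (by positivity)]
    apply ENNReal.ofReal_le_ofReal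
    have e : s - t + τ = s + τ - t := by ring
    rw [e, ← mul_assoc]
    refine mul_le_mul_of_nonneg_right ?_ (hH0 _)
    have habs : |ω (s - t) - ω (-t)| ≤ |ω (s - t)| + |ω (-t)| := abs_sub _ _
    calc Real.exp (δ₀₁ * s + 2 * ε * |ω (s - t) - ω (-t)|)
        ≤ Real.exp (((δ₀₁ - δ₀) * (s - t) + 2 * ε * |ω (s - t)|)
            + (δ₀₁ * t + 2 * ε * |ω (-t)|) + δ₀ * (s - t)) := by
          apply Real.exp_le_exp.mpr
          nlinarith [mul_le_mul_of_nonneg_left habs hε.le]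
      _ = Real.exp ((δ₀₁ - δ₀) * (s - t) + 2 * ε * |ω (s - t)|)
            * Real.exp (δ₀₁ * t + 2 * ε * |ω (-t)|) * Real.exp (δ₀ * (s - t)) := by
          rw [Real.exp_add, Real.exp_add]
      _ ≤ _ := by gcongr
  · have h1 : s ∉ Set.Iic (0 : ℝ) := hs
    simp [Set.indicator_of_notMem h1]
end

section
/- Let ω : ℝ → ℝ be continuous with ω(s)/s → 0 as s → −∞, let 0 < δ₀ < δ₀₁ < δ₁ and ε > 0, let τ ∈ ℝ, and let H : ℝ → [0, ∞) be measurable with ∫_{−∞}^{τ} e^{δ₀ r} H(r) dr < ∞. Then lim_{t → +∞} e^{−δ₁ t} ∫_{−∞}^{0} e^{δ₀₁ s + 2ε|ω(s−t) − ω(−t)|} H(s + τ − t) ds = 0. -/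
open MeasureTheory Real Filter

/-- the pullback-translated absorbing radius grows slower than e^{δ₁ t}
(membership of the absorbing family in the attraction universe, Lemma 4.1). -/
theorem tempered_radius_decay (ω : ℝ → ℝ) (hω : Continuous ω)
    (hlil : Tendsto (fun s => ω s / s) atBot (nhds 0))
    (δ₀ δ₀₁ δ₁ ε τ : ℝ) (h0 : 0 < δ₀) (h01 : δ₀ < δ₀₁) (h11 : δ₀₁ < δ₁) (hε : 0 < ε)
    (H : ℝ → ℝ) (hHm : Measurable H) (hH0 : ∀ s, 0 ≤ H s)
    (hHint : (∫⁻ r in Set.Iic τ, ENNReal.ofReal (Real.exp (δ₀ * r) * H r)) < ⊤) :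
    Tendsto (fun t : ℝ => ENNReal.ofReal (Real.exp (-δ₁ * t)) *
        ∫⁻ s in Set.Iic (0 : ℝ),
          ENNReal.ofReal (Real.exp (δ₀₁ * s + 2 * ε * |ω (s - t) - ω (-t)|) * H (s + τ - t)))
      atTop (nhds 0) := by
  set a := (δ₀₁ - δ₀) / 4 with ha
  have hapos : 0 < a := by rw [ha]; linarith
  set η := a / (2 * ε) with hη
  have hηpos : 0 < η := by positivity
  have hηa : 2 * ε * η = a := by rw [hη]; field_simp
  set g : ℝ → ENNReal := fun r => ENNReal.ofReal (Real.exp (δ₀ * r) * H r) with hg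
  have hlin : ∀ᶠ x in atBot, |ω x| ≤ η * (-x) := by
    have h1 := (Metric.tendsto_nhds.1 hlil) η hηpos
    filter_upwards [h1, eventually_lt_atBot (0 : ℝ)] with x hx hx0
    rw [Real.dist_eq, sub_zero, abs_div, abs_of_neg hx0, div_lt_iff₀ (by linarith)] at hx
    exact hx.le
  obtain ⟨b, hb⟩ := eventually_atBot.1 hlin
  have hbound : ∀ᶠ t : ℝ in atTop, ENNReal.ofReal (Real.exp (-δ₁ * t)) *
        (∫⁻ s in Set.Iic (0 : ℝ),
          ENNReal.ofReal (Real.exp (δ₀₁ * s + 2 * ε * |ω (s - t) - ω (-t)|) * H (s + τ - t)))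
        ≤ ENNReal.ofReal (Real.exp (-δ₀ * τ - 2 * a * t)) * ∫⁻ r in Set.Iic τ, g r := by
    filter_upwards [eventually_ge_atTop (-b), eventually_ge_atTop (0 : ℝ)] with t ht ht0
    rw [← lintegral_const_mul' _ _ ENNReal.ofReal_ne_top]
    calc _ ≤ ∫⁻ s in Set.Iic (0 : ℝ), ENNReal.ofReal (Real.exp (-δ₀ * τ - 2 * a * t)) *
            (Set.Iic τ).indicator g (s + (τ - t)) := by
          apply setLIntegral_mono' measurableSet_Iic
          intro s hs
          have hs : s ≤ 0 := hs
          have hmem : s + (τ - t) ∈ Set.Iic τ := by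
            simp only [Set.mem_Iic]; linarith
          rw [Set.indicator_of_mem hmem, hg, ← ENNReal.ofReal_mul (Real.exp_pos _).le,
            ← ENNReal.ofReal_mul (Real.exp_pos _).le, ← mul_assoc, ← mul_assoc,
            ← Real.exp_add, ← Real.exp_add, add_sub_assoc]
          apply ENNReal.ofReal_le_ofReal
          apply mul_le_mul_of_nonneg_right _ (hH0 _)
          apply Real.exp_le_exp.2
          have e1 := hb (s - t) (by linarith)
          have e2 := hb (-t) (by linarith)
          have e3 : |ω (s - t) - ω (-t)| ≤ η * (2 * t - s) := by
            have := abs_sub (ω (s - t)) (ω (-t))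
            linarith
          have e4 : 2 * ε * |ω (s - t) - ω (-t)| ≤ a * (2 * t - s) := by
            rw [← hηa, mul_assoc (2 * ε)]
            exact mul_le_mul_of_nonneg_left e3 (by positivity)
          have e5 : δ₀₁ = δ₀ + 4 * a := by rw [ha]; ring
          have e6 : 0 ≤ (δ₁ - δ₀₁) * t := mul_nonneg (by linarith) ht0
          have e7 : 0 ≤ a * (-s) := mul_nonneg hapos.le (by linarith)
          rw [e5] at e6 ⊢
          nlinarith
      _ ≤ ∫⁻ s, ENNReal.ofReal (Real.exp (-δ₀ * τ - 2 * a * t)) *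
            (Set.Iic τ).indicator g (s + (τ - t)) := setLIntegral_le_lintegral _ _
      _ = _ := by
          rw [lintegral_const_mul' _ _ ENNReal.ofReal_ne_top,
            lintegral_add_right_eq_self (fun x => (Set.Iic τ).indicator g x),
            lintegral_indicator measurableSet_Iic]
  have hlim : Tendsto (fun t : ℝ => ENNReal.ofReal (Real.exp (-δ₀ * τ - 2 * a * t)) *
      ∫⁻ r in Set.Iic τ, g r) atTop (nhds 0) := by
    have h1 : Tendsto (fun t : ℝ => Real.exp (-δ₀ * τ - 2 * a * t)) atTop (nhds 0) := by
      apply Real.tendsto_exp_atBot.comp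
      have h2 : Tendsto (fun t : ℝ => 2 * a * t) atTop atTop :=
        tendsto_id.const_mul_atTop (by positivity)
      simpa [sub_eq_add_neg] using
        tendsto_atBot_add_const_left atTop (-δ₀ * τ) (tendsto_neg_atTop_atBot.comp h2)
    have h3 := ENNReal.tendsto_ofReal h1
    rw [ENNReal.ofReal_zero] at h3
    have h4 := ENNReal.Tendsto.mul_const h3 (Or.inr hHint.ne)
    rwa [zero_mul] at h4
  exact tendsto_of_tendsto_of_tendsto_of_le_of_le' tendsto_const_nhds hlim
    (Eventually.of_forall fun _ => zero_le) hbound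
end

section
/- Let ω : ℝ → ℝ be continuous with ω(s)/s → 0 as s → −∞, let 0 < δ₀ < δ₀₁ and ε > 0, let τ ∈ ℝ, and let H : ℝ → [0, ∞) be measurable with ∫_{−∞}^{τ} e^{δ₀ s} H(s) ds < ∞. Then ∫_{−∞}^{0} e^{δ₀₁ s + 2ε|ω(s)|} H(s + τ) ds < ∞. -/
open MeasureTheory Real Filter

/-- finiteness of the random constant L_ε(τ, ω) in Lemma 4.1. -/
theorem random_constant_finite (ω : ℝ → ℝ) (hω : Continuous ω)
    (hlil : Tendsto (fun s => ω s / s) atBot (nhds 0))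
    (δ₀ δ₀₁ ε τ : ℝ) (h0 : 0 < δ₀) (h01 : δ₀ < δ₀₁) (hε : 0 < ε)
    (H : ℝ → ℝ) (hHm : Measurable H) (hH0 : ∀ s, 0 ≤ H s)
    (hHint : (∫⁻ s in Set.Iic τ, ENNReal.ofReal (Real.exp (δ₀ * s) * H s)) < ⊤) :
    (∫⁻ s in Set.Iic (0 : ℝ),
        ENNReal.ofReal (Real.exp (δ₀₁ * s + 2 * ε * |ω s|) * H (s + τ))) < ⊤ := by
  have hC : ∃ C : ℝ, ∀ s ≤ 0, δ₀₁ * s + 2 * ε * |ω s| ≤ δ₀ * s + C := by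
    have hpos : 0 < (δ₀₁ - δ₀) / (2 * ε) := div_pos (by linarith) (by linarith)
    have h1 := (Metric.tendsto_nhds.1 hlil) _ hpos
    obtain ⟨N, hN⟩ := eventually_atBot.1 (h1.and (eventually_lt_atBot (0 : ℝ)))
    obtain ⟨C, hCb⟩ := (isCompact_Icc (a := N) (b := (0 : ℝ))).exists_bound_of_continuousOn
      (f := fun s => (δ₀₁ - δ₀) * s + 2 * ε * |ω s|) (by fun_prop)
    refine ⟨max C 0, fun s hs => ?_⟩
    rcases le_total s N with h | h
    · obtain ⟨ha, hb⟩ := hN s h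
      rw [Real.dist_eq, sub_zero, abs_div, abs_of_neg hb, div_lt_div_iff₀ (by linarith) (by linarith)] at ha
      nlinarith [le_max_right C 0]
    · have h2 := (le_abs_self _).trans (hCb s ⟨h, hs⟩)
      nlinarith [le_max_left C 0]
  obtain ⟨C, hC⟩ := hC
  have hcv : (∫⁻ s in Set.Iic (0 : ℝ), ENNReal.ofReal (Real.exp (δ₀ * (s + τ)) * H (s + τ)))
      = ∫⁻ s in Set.Iic τ, ENNReal.ofReal (Real.exp (δ₀ * s) * H s) := by
    have := (measurePreserving_add_right volume τ).setLIntegral_comp_preimage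
      (measurableSet_Iic (a := τ))
      (f := fun s => ENNReal.ofReal (Real.exp (δ₀ * s) * H s)) (by fun_prop)
    rw [← this]
    simp
  calc _ ≤ ∫⁻ s in Set.Iic (0 : ℝ), ENNReal.ofReal (Real.exp (C - δ₀ * τ)) *
        ENNReal.ofReal (Real.exp (δ₀ * (s + τ)) * H (s + τ)) := by
        refine setLIntegral_mono' measurableSet_Iic fun s hs => ?_
        rw [← ENNReal.ofReal_mul (Real.exp_pos _).le, ← mul_assoc, ← Real.exp_add]
        refine ENNReal.ofReal_le_ofReal (mul_le_mul_of_nonneg_right ?_ (hH0 _))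
        exact Real.exp_le_exp.2 (by linarith [hC s hs])
    _ = ENNReal.ofReal (Real.exp (C - δ₀ * τ)) *
        ∫⁻ s in Set.Iic τ, ENNReal.ofReal (Real.exp (δ₀ * s) * H s) := by
        rw [lintegral_const_mul' _ _ ENNReal.ofReal_ne_top, hcv]
    _ < ⊤ := ENNReal.mul_lt_top ENNReal.ofReal_lt_top hHint
end

section
/- Let X be a metric space and Ω a set equipped with a family of maps θ_t : Ω → Ω (t ∈ ℝ) satisfying θ₀ = id and θ_{s+t} = θ_s ∘ θ_t for all s, t ∈ ℝ. Let φ : [0, ∞) × ℝ × Ω × X → X satisfy: (a) φ(0, τ, ω, x) = x for all τ, ω, x; (b) the cocycle property φ(t + s, τ, ω, x) = φ(t, τ + s, θ_s ω, φ(s, τ, ω, x)) for all t, s ≥ 0, τ ∈ ℝ, ω ∈ Ω, x ∈ X; (c) for each t ≥ 0, τ ∈ ℝ, ω ∈ Ω the map x ↦ φ(t, τ, ω, x) is continuous. Suppose u* : ℝ × Ω → X is such that for every τ ∈ ℝ, ω ∈ Ω and every x ∈ X, φ(s, τ − s, θ_{−s} ω, x) → u*(τ, ω) as s → +∞. Then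 u* is an equilibrium of φ: for every t ≥ 0, τ ∈ ℝ and ω ∈ Ω, φ(t, τ, ω, u*(τ, ω)) = u*(τ + t, θ_t ω). -/
open Filter

/-- the pullback limit of a continuous random cocycle is an equilibrium
(abstract invariance argument of Lemma 5.4). -/
theorem pullback_limit_is_equilibrium {X : Type*} [MetricSpace X] {Ω : Type*}
    (θ : ℝ → Ω → Ω) (hθ0 : ∀ ω, θ 0 ω = ω)
    (hθadd : ∀ s t : ℝ, ∀ ω, θ (s + t) ω = θ s (θ t ω))
    (φ : ℝ → ℝ → Ω → X → X)
    (hφ0 : ∀ (τ : ℝ) (ω : Ω) (x : X), φ 0 τ ω x = x)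
    (hcocycle : ∀ t s : ℝ, 0 ≤ t → 0 ≤ s → ∀ (τ : ℝ) (ω : Ω) (x : X),
      φ (t + s) τ ω x = φ t (τ + s) (θ s ω) (φ s τ ω x))
    (hcont : ∀ t : ℝ, 0 ≤ t → ∀ (τ : ℝ) (ω : Ω), Continuous (φ t τ ω))
    (ustar : ℝ → Ω → X)
    (hconv : ∀ (τ : ℝ) (ω : Ω) (x : X),
      Tendsto (fun s => φ s (τ - s) (θ (-s) ω) x) atTop (nhds (ustar τ ω))) :
    ∀ t : ℝ, 0 ≤ t → ∀ (τ : ℝ) (ω : Ω),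
      φ t τ ω (ustar τ ω) = ustar (τ + t) (θ t ω) := by
  intro t ht τ ω
  have h1 : Tendsto (fun s => φ t τ ω (φ s (τ - s) (θ (-s) ω) (ustar τ ω))) atTop
      (nhds (φ t τ ω (ustar τ ω))) :=
    ((hcont t ht τ ω).tendsto _).comp (hconv τ ω (ustar τ ω))
  have h2 := (hconv (τ + t) (θ t ω) (ustar τ ω)).comp (tendsto_atTop_add_const_left atTop t tendsto_id)
  refine tendsto_nhds_unique_of_eventuallyEq h1 h2 ?_
  filter_upwards [eventually_ge_atTop (0 : ℝ)] with s hs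
  have e1 : τ + t - (t + s) = τ - s := by ring
  have e2 : θ (-(t + s)) (θ t ω) = θ (-s) ω := by
    rw [← hθadd]
    congr 1
    ring
  have e3 : θ s (θ (-s) ω) = ω := by
    rw [← hθadd, add_neg_cancel, hθ0]
  simp only [Function.comp, id]
  rw [e1, e2, hcocycle t s ht hs, e3, sub_add_cancel]
end
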